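/- For every α ∈ (0, 1/√(2π)) and every q ∈ ℝ with Φ(q) = 1 − α, one has q > √(−log(2πα²·(1 − log(2πα²)))). (Note that for such α one has 2πα² ∈ (0,1), so 2πα²·(1 − log(2πα²)) ∈ (0,1) and the argument of the square root is positive.) -/

import Mathlib

open Real MeasureTheory

/-- The cumulative distribution function of the standard Gaussian distribution. -/
noncomputable def Phi (x : ℝ) : ℝ :=
  (Real.sqrt (2 * Real.pi))⁻¹ * ∫ u in Set.Iic x, Real.exp (-u ^ 2 / 2)

/-- Birnbaum's lower bound for the Mills ratio of the standard Gaussian distribution. -/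
noncomputable def birnbaum (s : ℝ) : ℝ := (Real.sqrt (s ^ 2 + 4) - s) / 2

lemma birnbaum_pos (s : ℝ) : 0 < birnbaum s := by
  have h : s < Real.sqrt (s ^ 2 + 4) := Real.lt_sqrt_of_sq_lt (by linarith)
  unfold birnbaum
  linarith

lemma birnbaum_sq (s : ℝ) : birnbaum s ^ 2 + s * birnbaum s = 1 := by
  have h : Real.sqrt (s ^ 2 + 4) ^ 2 = s ^ 2 + 4 := Real.sq_sqrt (by positivity)
  unfold birnbaum
  linear_combination h / 4

lemma birnbaum_lt_one {s : ℝ} (hs : 0 < s) : birnbaum s < 1 := by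
  nlinarith [birnbaum_sq s, mul_pos hs (birnbaum_pos s)]

lemma hasDerivAt_birnbaum (s : ℝ) :
    HasDerivAt birnbaum (-(birnbaum s / Real.sqrt (s ^ 2 + 4))) s := by
  have hpos : 0 < s ^ 2 + 4 := by positivity
  have h1 : HasDerivAt (fun u : ℝ => u ^ 2 + 4) (2 * s) s := by
    simpa using (hasDerivAt_pow 2 s).add_const 4
  have h2 := ((h1.sqrt hpos.ne').sub (hasDerivAt_id s)).div_const 2
  have hne : Real.sqrt (s ^ 2 + 4) ≠ 0 := (Real.sqrt_pos.2 hpos).ne'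
  refine h2.congr_deriv ?_
  unfold birnbaum
  field_simp
  ring

lemma integrable_exp_neg_sq_div_two : Integrable fun u : ℝ => Real.exp (-u ^ 2 / 2) := by
  refine (integrable_exp_neg_mul_sq (b := 1 / 2) (by norm_num)).congr (ae_of_all _ fun u => ?_)
  simp only
  congr 1
  ring

lemma integral_exp_neg_sq_div_two :
    ∫ u : ℝ, Real.exp (-u ^ 2 / 2) = Real.sqrt (2 * Real.pi) := by
  have h := integral_gaussian (1 / 2)
  rw [show Real.pi / (1 / 2) = 2 * Real.pi by ring] at h
  rw [← h]
  congr 1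
  ext u
  congr 1
  ring

/-- Birnbaum's inequality for the Gaussian tail. -/
lemma birnbaum_mul_exp_le_integral {s : ℝ} (hs : 0 ≤ s) :
    birnbaum s * Real.exp (-s ^ 2 / 2) ≤ ∫ u in Set.Ioi s, Real.exp (-u ^ 2 / 2) := by
  have hderiv (u : ℝ) : HasDerivAt (fun v => -(birnbaum v * Real.exp (-v ^ 2 / 2)))
      ((birnbaum u / Real.sqrt (u ^ 2 + 4) + u * birnbaum u) * Real.exp (-u ^ 2 / 2)) u := by
    have h1 : HasDerivAt (fun v : ℝ => -v ^ 2 / 2) (-u) u :=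
      ((hasDerivAt_pow 2 u).neg.div_const 2).congr_deriv (by simp; ring)
    refine ((hasDerivAt_birnbaum u).mul h1.exp).neg.congr_deriv ?_
    ring
  have hle (u : ℝ) : birnbaum u / Real.sqrt (u ^ 2 + 4) + u * birnbaum u ≤ 1 := by
    have hr : 0 < Real.sqrt (u ^ 2 + 4) := Real.sqrt_pos.2 (by positivity)
    have hsq : Real.sqrt (u ^ 2 + 4) ^ 2 = u ^ 2 + 4 := Real.sq_sqrt (by positivity)
    have h1 : 1 ≤ birnbaum u * Real.sqrt (u ^ 2 + 4) := by
      unfold birnbaum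
      nlinarith [sq_nonneg (Real.sqrt (u ^ 2 + 4) - u)]
    have h2 : birnbaum u / Real.sqrt (u ^ 2 + 4) ≤ birnbaum u ^ 2 := by
      rw [div_le_iff₀ hr]
      nlinarith [birnbaum_pos u]
    linarith [birnbaum_sq u]
  have hnonneg (u : ℝ) (hu : u ∈ Set.Ioi s) :
      0 ≤ (birnbaum u / Real.sqrt (u ^ 2 + 4) + u * birnbaum u) * Real.exp (-u ^ 2 / 2) := by
    have hu' : 0 ≤ u := hs.trans (le_of_lt hu)
    have := birnbaum_pos u
    positivity
  have hexp : Filter.Tendsto (fun u : ℝ => Real.exp (-u ^ 2 / 2)) Filter.atTop (nhds 0) := by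
    refine Real.tendsto_exp_atBot.comp ?_
    have h := (Filter.tendsto_pow_atTop (α := ℝ) two_ne_zero).atTop_div_const
      (two_pos : (0 : ℝ) < 2)
    refine (Filter.tendsto_neg_atTop_atBot.comp h).congr fun u => ?_
    simp only [Function.comp_apply]
    ring
  have hlim : Filter.Tendsto (fun v => -(birnbaum v * Real.exp (-v ^ 2 / 2)))
      Filter.atTop (nhds 0) := by
    rw [← neg_zero]
    refine (squeeze_zero' (.of_forall fun u => ?_) ?_ hexp).neg
    · exact mul_nonneg (birnbaum_pos u).le (Real.exp_pos _).le
    · filter_upwards [Filter.eventually_gt_atTop 0] with u hu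
      exact mul_le_of_le_one_left (Real.exp_pos _).le (birnbaum_lt_one hu).le
  have hint := integrableOn_Ioi_deriv_of_nonneg' (fun u _ => hderiv u) hnonneg hlim
  have heq := integral_Ioi_of_hasDerivAt_of_tendsto' (fun u _ => hderiv u) hint hlim
  rw [zero_sub, neg_neg] at heq
  rw [← heq]
  refine setIntegral_mono hint integrable_exp_neg_sq_div_two.integrableOn fun u => ?_
  exact mul_le_of_le_one_left (Real.exp_pos _).le (hle u)

lemma mul_one_sub_log_le {x y : ℝ} (hy : 0 < y) (hyx : y ≤ x) (hx : x ≤ 1) :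
    y * (1 - Real.log y) ≤ x * (1 - Real.log x) := by
  have hx0 : 0 < x := hy.trans_le hyx
  have h := Real.log_le_sub_one_of_pos (div_pos hx0 hy)
  rw [Real.log_div hx0.ne' hy.ne'] at h
  have h2 : y * (Real.log x - Real.log y) ≤ x - y := by
    have := mul_le_mul_of_nonneg_left h hy.le
    rwa [mul_sub, mul_sub, mul_div_cancel₀ _ hy.ne', mul_one, ← mul_sub] at this
  nlinarith [mul_nonneg (sub_nonneg.2 hyx) (neg_nonneg.2 (Real.log_nonpos hx0.le hx))]

lemma mul_one_sub_log_lt_one {x : ℝ} (hx : 0 < x) (hx1 : x < 1) :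
    x * (1 - Real.log x) < 1 := by
  have h := Real.log_lt_sub_one_of_pos (inv_pos.2 hx) (by simpa using hx1.ne)
  rw [Real.log_inv] at h
  have := mul_lt_mul_of_pos_left h hx
  rw [mul_sub, mul_inv_cancel₀ hx.ne'] at this
  linarith

lemma exp_neg_sq_lt_birnbaum {s : ℝ} (hs : 0 < s) :
    Real.exp (-s ^ 2) < (birnbaum s * Real.exp (-s ^ 2 / 2)) ^ 2 *
      (1 - Real.log ((birnbaum s * Real.exp (-s ^ 2 / 2)) ^ 2)) := by
  have hm := birnbaum_pos s
  have hm1 := birnbaum_lt_one hs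
  have he : Real.exp (-s ^ 2 / 2) ^ 2 = Real.exp (-s ^ 2) := by
    rw [← Real.exp_nat_mul]
    congr 1
    push_cast
    ring
  have hlog : Real.log (birnbaum s ^ 2) < birnbaum s ^ 2 - 1 :=
    Real.log_lt_sub_one_of_pos (by positivity) (by nlinarith)
  rw [mul_pow, he, Real.log_mul (by positivity) (Real.exp_pos _).ne', Real.log_exp]
  have key : 1 < birnbaum s ^ 2 * (1 - (Real.log (birnbaum s ^ 2) + -s ^ 2)) := by
    have hs2 : (s * birnbaum s) ^ 2 = (1 - birnbaum s ^ 2) ^ 2 := by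
      rw [← birnbaum_sq s]
      ring
    nlinarith [mul_lt_mul_of_pos_left hlog (pow_pos hm 2)]
  nlinarith [mul_lt_mul_of_pos_left key (Real.exp_pos (-s ^ 2))]

theorem inverse_gaussian_cdf_lower_bound
    (α q : ℝ) (hα : α ∈ Set.Ioo 0 (1 / Real.sqrt (2 * Real.pi)))
    (hq : Phi q = 1 - α) :
    q > Real.sqrt (-Real.log (2 * Real.pi * α ^ 2 *
      (1 - Real.log (2 * Real.pi * α ^ 2)))) := by
  obtain ⟨hα0, hα1⟩ := hα
  have hr : 0 < Real.sqrt (2 * Real.pi) := by positivity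
  rw [lt_div_iff₀ hr] at hα1
  have hx : 2 * Real.pi * α ^ 2 = (Real.sqrt (2 * Real.pi) * α) ^ 2 := by
    rw [mul_pow, Real.sq_sqrt (by positivity)]
  have htail : ∫ u in Set.Ioi q, Real.exp (-u ^ 2 / 2) = Real.sqrt (2 * Real.pi) * α := by
    have hsplit := intervalIntegral.integral_Iic_add_Ioi (b := q)
      integrable_exp_neg_sq_div_two.integrableOn integrable_exp_neg_sq_div_two.integrableOn
    rw [integral_exp_neg_sq_div_two] at hsplit
    unfold Phi at hq
    rw [inv_mul_eq_iff_eq_mul₀ hr.ne'] at hq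
    linarith
  rw [hx]
  set t := Real.sqrt (2 * Real.pi) * α with ht
  have ht0 : 0 < t := mul_pos hr hα0
  have ht1 : t < 1 := by linarith
  have hx0 : 0 < t ^ 2 := by positivity
  have hx1 : t ^ 2 < 1 := by nlinarith
  have hh1 := mul_one_sub_log_lt_one hx0 hx1
  have hh0 : 0 < t ^ 2 * (1 - Real.log (t ^ 2)) :=
    mul_pos hx0 (by linarith [Real.log_neg hx0 hx1])
  have hlog := Real.log_neg hh0 hh1
  set s := Real.sqrt (-Real.log (t ^ 2 * (1 - Real.log (t ^ 2)))) with hs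
  have hs0 : 0 < s := Real.sqrt_pos.2 (by linarith)
  have hexp : Real.exp (-s ^ 2) = t ^ 2 * (1 - Real.log (t ^ 2)) := by
    rw [hs, Real.sq_sqrt (by linarith), neg_neg, Real.exp_log hh0]
  by_contra! hqs
  have hmono : ∫ u in Set.Ioi s, Real.exp (-u ^ 2 / 2) ≤
      ∫ u in Set.Ioi q, Real.exp (-u ^ 2 / 2) :=
    setIntegral_mono_set integrable_exp_neg_sq_div_two.integrableOn
      (ae_of_all _ fun u => (Real.exp_pos _).le) (Set.Ioi_subset_Ioi hqs).eventuallyLE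
  have hle : birnbaum s * Real.exp (-s ^ 2 / 2) ≤ t :=
    (birnbaum_mul_exp_le_integral hs0.le).trans (hmono.trans_eq htail)
  have hw : 0 < birnbaum s * Real.exp (-s ^ 2 / 2) := mul_pos (birnbaum_pos s) (Real.exp_pos _)
  have hlt := exp_neg_sq_lt_birnbaum hs0
  rw [hexp] at hlt
  exact absurd (mul_one_sub_log_le (pow_pos hw 2) (pow_le_pow_left₀ hw.le hle 2) hx1.le)
    (not_le.2 hlt)
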